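/- There exists a set P of 90 points in general position in the plane with cr(P) = 951459. In particular, the rectilinear crossing number satisfies cr(K_90) ≤ 951459 (improving the previously best known bound of 951526). -/

import Mathlib

/-- A finite planar point set is in general position if no three of its points are collinear. -/
def GenPos (P : Finset (ℝ × ℝ)) : Prop :=
  ∀ p ∈ P, ∀ q ∈ P, ∀ r ∈ P, p ≠ q → p ≠ r → q ≠ r →
    ¬ Collinear ℝ ({p, q, r} : Set (ℝ × ℝ))

/-- A set of points is in convex position if no point lies in the convex hull of the others. -/
def ConvexPos (S : Set (ℝ × ℝ)) : Prop :=
  ∀ p ∈ S, p ∉ convexHull ℝ (S \ {p})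

/-- `crNum P` is the number of 4-element subsets of `P` in convex position. -/
noncomputable def crNum (P : Finset (ℝ × ℝ)) : ℕ :=
  Set.ncard {Q : Finset (ℝ × ℝ) | Q ⊆ P ∧ Q.card = 4 ∧ ConvexPos (↑Q : Set (ℝ × ℝ))}

/-- The rectilinear crossing number of `K_n`: the minimum of `crNum P` over all sets `P` of `n`
points in general position in the plane. -/
noncomputable def rcn (n : ℕ) : ℕ :=
  sInf {c : ℕ | ∃ P : Finset (ℝ × ℝ), P.card = n ∧ GenPos P ∧ crNum P = c}

open Finset in
/-- If every `(k + 1)`-subset of `s` has at most one distinguished element, the subsets that have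
one can be counted by their distinguished element. -/
theorem card_filter_exists_distinguished {α : Type*} [DecidableEq α] (s : Finset α) (k : ℕ)
    (A : α → Finset α → Prop) [∀ p, DecidablePred (A p)]
    (huniq : ∀ Q ⊆ s, Q.card = k + 1 → ∀ p ∈ Q, ∀ q ∈ Q,
      A p (Q.erase p) → A q (Q.erase q) → p = q) :
    ((s.powersetCard (k + 1)).filter fun Q => ∃ p ∈ Q, A p (Q.erase p)).card =
      ∑ p ∈ s, (((s.erase p).powersetCard k).filter fun T => A p T).card := by
  have hunion : ((s.powersetCard (k + 1)).filter fun Q => ∃ p ∈ Q, A p (Q.erase p)) =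
      s.biUnion fun p => (((s.erase p).powersetCard k).filter fun T => A p T).image (insert p) := by
    ext Q
    simp only [mem_filter, mem_powersetCard, mem_biUnion, mem_image]
    constructor
    · rintro ⟨⟨hQ, hcard⟩, p, hp, hA⟩
      exact ⟨p, hQ hp, Q.erase p, ⟨⟨erase_subset_erase p hQ, by
        rw [card_erase_of_mem hp, hcard]; rfl⟩, hA⟩, insert_erase hp⟩
    · rintro ⟨p, hp, T, ⟨⟨hT, hcard⟩, hA⟩, rfl⟩
      have hpT : p ∉ T := fun h => (mem_erase.1 (hT h)).1 rfl
      refine ⟨⟨insert_subset hp (hT.trans (erase_subset _ _)), by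
        rw [card_insert_of_notMem hpT, hcard]⟩, p, mem_insert_self _ _, ?_⟩
      rwa [erase_insert hpT]
  rw [hunion, card_biUnion]
  · refine sum_congr rfl fun p _ => card_image_of_injOn fun T hT T' hT' h => ?_
    simp only [coe_filter, mem_powersetCard, Set.mem_ofPred_eq] at hT hT'
    have hpT : p ∉ T := fun h => (mem_erase.1 (hT.1.1 h)).1 rfl
    have hpT' : p ∉ T' := fun h => (mem_erase.1 (hT'.1.1 h)).1 rfl
    rw [← erase_insert hpT, h, erase_insert hpT']
  · intro p hp q hq hpq
    refine disjoint_left.2 fun Q hQ hQ' => hpq ?_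
    simp only [mem_image, mem_filter, mem_powersetCard] at hQ hQ'
    obtain ⟨T, ⟨⟨hT, hcard⟩, hA⟩, rfl⟩ := hQ
    obtain ⟨T', ⟨⟨hT', hcard'⟩, hA'⟩, hTT'⟩ := hQ'
    have hpT : p ∉ T := fun h => (mem_erase.1 (hT h)).1 rfl
    have hqT' : q ∉ T' := fun h => (mem_erase.1 (hT' h)).1 rfl
    refine huniq _ (insert_subset hp (hT.trans (erase_subset _ _)))
      (by rw [card_insert_of_notMem hpT, hcard]) p (mem_insert_self _ _) q ?_ ?_ ?_
    · rw [← hTT']; exact mem_insert_self _ _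
    · rwa [erase_insert hpT]
    · rwa [← hTT', erase_insert hqT']

open Finset in
/-- For an asymmetric relation on `s`, the triples with a source are counted by the out-degrees. -/
theorem card_triples_with_source {α : Type*} [DecidableEq α] (s : Finset α)
    (R : α → α → Prop) [DecidableRel R] (hasymm : ∀ q r, R q r → ¬ R r q) :
    ((s.powersetCard 3).filter fun T => ∃ q ∈ T, ∀ r ∈ T.erase q, R q r).card =
      ∑ q ∈ s, (s.filter (R q)).card.choose 2 := by
  have hirrefl : ∀ q, ¬ R q q := fun q h => hasymm q q h h
  refine (card_filter_exists_distinguished s 2 (fun q T => ∀ r ∈ T, R q r) ?_).trans ?_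
  rotate_left
  · refine sum_congr rfl fun q _ => ?_
    rw [← card_powersetCard]
    congr 1
    ext T
    simp only [mem_filter, mem_powersetCard, subset_iff, mem_erase]
    grind
  · intro Q _ _ p hp q hq h h'
    by_contra hne
    exact hasymm p q (h q (mem_erase.2 ⟨Ne.symm hne, hq⟩)) (h' p (mem_erase.2 ⟨hne, hp⟩))

/-- Twice the signed area of the triangle `p q r`. -/
def signedArea (p q r : ℝ × ℝ) : ℝ :=
  (q.1 - p.1) * (r.2 - p.2) - (q.2 - p.2) * (r.1 - p.1)

theorem signedArea_swap (p q r : ℝ × ℝ) : signedArea p r q = -signedArea p q r := by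
  unfold signedArea; ring

theorem signedArea_swap_left (p q r : ℝ × ℝ) : signedArea q p r = -signedArea p q r := by
  unfold signedArea; ring

theorem signedArea_rotate (p q r : ℝ × ℝ) : signedArea q r p = signedArea p q r := by
  unfold signedArea; ring

theorem signedArea_add (p q r s : ℝ × ℝ) :
    signedArea p q r + signedArea p r s + signedArea p s q = signedArea q r s := by
  unfold signedArea; ring

theorem signedArea_eq_zero_of_collinear {p q r : ℝ × ℝ}
    (h : Collinear ℝ ({p, q, r} : Set (ℝ × ℝ))) : signedArea p q r = 0 := by
  obtain ⟨v, hv⟩ := (collinear_iff_of_mem (Set.mem_insert p {q, r})).1 h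
  obtain ⟨a, rfl⟩ := hv q (by simp)
  obtain ⟨b, rfl⟩ := hv r (by simp)
  simp only [signedArea, vadd_eq_add, Prod.fst_add, Prod.snd_add, Prod.smul_fst, Prod.smul_snd,
    smul_eq_mul]
  ring

/-- A point lies in a triangle exactly when it sees the three sides with the same orientation. -/
theorem mem_convexHull_triple_iff {p q r s : ℝ × ℝ} (h₁ : signedArea p q r ≠ 0)
    (h₂ : signedArea p r s ≠ 0) (h₃ : signedArea p s q ≠ 0) (h : signedArea q r s ≠ 0) :
    p ∈ convexHull ℝ ({q, r, s} : Set (ℝ × ℝ)) ↔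
      (0 < signedArea p q r ∧ 0 < signedArea p r s ∧ 0 < signedArea p s q) ∨
      (signedArea p q r < 0 ∧ signedArea p r s < 0 ∧ signedArea p s q < 0) := by
  constructor
  · intro hp
    rw [convexHull_insert (Set.insert_nonempty r {s}), convexHull_pair,
      convexJoin_singleton_left] at hp
    simp only [Set.mem_iUnion] at hp
    obtain ⟨z, ⟨c, d, hc, hd, hcd, rfl⟩, a, b, ha, hb, hab, rfl⟩ := hp
    obtain rfl : a = 1 - b := by linarith
    obtain rfl : c = 1 - d := by linarith
    set p := (1 - b) • q + b • ((1 - d) • r + d • s) with hp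
    have e₁ : signedArea p q r = b * d * signedArea q r s := by
      simp [hp, signedArea]; ring
    have e₂ : signedArea p r s = (1 - b) * signedArea q r s := by
      simp [hp, signedArea]; ring
    have e₃ : signedArea p s q = b * (1 - d) * signedArea q r s := by
      simp [hp, signedArea]; ring
    rcases lt_or_gt_of_ne h with hneg | hpos
    · exact Or.inr ⟨h₁.lt_of_le (e₁ ▸ mul_nonpos_of_nonneg_of_nonpos (by positivity) hneg.le),
        h₂.lt_of_le (e₂ ▸ mul_nonpos_of_nonneg_of_nonpos ha hneg.le),
        h₃.lt_of_le (e₃ ▸ mul_nonpos_of_nonneg_of_nonpos (by positivity) hneg.le)⟩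
    · exact Or.inl ⟨h₁.symm.lt_of_le (e₁ ▸ by positivity),
        h₂.symm.lt_of_le (e₂ ▸ by positivity), h₃.symm.lt_of_le (e₃ ▸ by positivity)⟩
  · intro hsign
    set D := signedArea q r s with hD
    have hsum := signedArea_add p q r s
    have hp : p = (signedArea p r s / D) • q + (signedArea p s q / D) • r +
        (signedArea p q r / D) • s := by
      ext
      · simp only [Prod.fst_add, Prod.smul_fst, smul_eq_mul]
        field_simp
        simp only [hD, signedArea]; ring
      · simp only [Prod.snd_add, Prod.smul_snd, smul_eq_mul]
        field_simp
        simp only [hD, signedArea]; ring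
    have hw : 0 ≤ signedArea p r s / D ∧ 0 ≤ signedArea p s q / D ∧ 0 ≤ signedArea p q r / D := by
      rcases hsign with ⟨k₁, k₂, k₃⟩ | ⟨k₁, k₂, k₃⟩
      · have : 0 < D := by linarith
        exact ⟨by positivity, by positivity, by positivity⟩
      · have : D ≤ 0 := by linarith
        exact ⟨div_nonneg_of_nonpos k₂.le this, div_nonneg_of_nonpos k₃.le this,
          div_nonneg_of_nonpos k₁.le this⟩
    have hone : signedArea p r s / D + signedArea p s q / D + signedArea p q r / D = 1 := by
      rw [← add_div, ← add_div, div_eq_one_iff_eq h]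
      linarith
    have hq : q ∈ convexHull ℝ ({q, r, s} : Set (ℝ × ℝ)) := subset_convexHull _ _ (by simp)
    have hr : r ∈ convexHull ℝ ({q, r, s} : Set (ℝ × ℝ)) := subset_convexHull _ _ (by simp)
    have hs : s ∈ convexHull ℝ ({q, r, s} : Set (ℝ × ℝ)) := subset_convexHull _ _ (by simp)
    rw [hp]
    have hmem := (convex_convexHull ℝ ({q, r, s} : Set (ℝ × ℝ))).sum_mem (t := Finset.univ)
      (w := ![signedArea p r s / D, signedArea p s q / D, signedArea p q r / D])
      (z := ![q, r, s]) (by simpa [Fin.forall_fin_succ] using hw)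
      (by simpa [Fin.sum_univ_three] using hone) (by simp [Fin.forall_fin_succ, hq, hr, hs])
    simpa [Fin.sum_univ_three] using hmem

open Finset in
/-- A point lies in the hull of three others exactly when, seen from it, none of the three comes
clockwise first. -/
theorem mem_convexHull_iff_not_exists_source {P : Finset (ℝ × ℝ)}
    (hP : ∀ p ∈ P, ∀ q ∈ P, ∀ r ∈ P, p ≠ q → p ≠ r → q ≠ r → signedArea p q r ≠ 0)
    {p : ℝ × ℝ} (hp : p ∈ P) {T : Finset (ℝ × ℝ)} (hT : T ⊆ P.erase p) (hcard : T.card = 3) :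
    p ∈ convexHull ℝ (T : Set (ℝ × ℝ)) ↔
      ¬ ∃ q ∈ T, ∀ r ∈ T.erase q, 0 < signedArea p q r := by
  obtain ⟨q, r, s, hqr, hqs, hrs, rfl⟩ := card_eq_three.1 hcard
  obtain ⟨hqp, hq⟩ := mem_erase.1 (hT (by simp : q ∈ _))
  obtain ⟨hrp, hr⟩ := mem_erase.1 (hT (by simp : r ∈ _))
  obtain ⟨hsp, hs⟩ := mem_erase.1 (hT (by simp : s ∈ _))
  have h₁ := hP p hp q hq r hr hqp.symm hrp.symm hqr
  have h₂ := hP p hp r hr s hs hrp.symm hsp.symm hrs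
  have h₃ := hP p hp s hs q hq hsp.symm hqp.symm hqs.symm
  have h := hP q hq r hr s hs hqr hqs hrs
  have e₁ := signedArea_swap p q r
  have e₂ := signedArea_swap p r s
  have e₃ := signedArea_swap p s q
  simp only [coe_insert, coe_singleton, mem_convexHull_triple_iff h₁ h₂ h₃ h, mem_erase, mem_insert,
    mem_singleton, exists_eq_or_imp, exists_eq_left]
  grind

open Finset in
/-- Of four points in general position, at most one lies in the hull of the others. -/
theorem eq_of_mem_convexHull_erase {P : Finset (ℝ × ℝ)}
    (hP : ∀ p ∈ P, ∀ q ∈ P, ∀ r ∈ P, p ≠ q → p ≠ r → q ≠ r → signedArea p q r ≠ 0)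
    {Q : Finset (ℝ × ℝ)} (hQ : Q ⊆ P) (hcard : Q.card = 4) {p q : ℝ × ℝ} (hp : p ∈ Q) (hq : q ∈ Q)
    (hpQ : p ∈ convexHull ℝ (Q.erase p : Set (ℝ × ℝ)))
    (hqQ : q ∈ convexHull ℝ (Q.erase q : Set (ℝ × ℝ))) : p = q := by
  by_contra hpq
  have hcard' : ((Q.erase p).erase q).card = 2 := by
    rw [card_erase_of_mem (mem_erase.2 ⟨Ne.symm hpq, hq⟩), card_erase_of_mem hp, hcard]
  obtain ⟨r, s, hrs, hQrs⟩ := card_eq_two.1 hcard'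
  have hp' : Q.erase p = {q, r, s} := by
    rw [← hQrs, insert_erase (mem_erase.2 ⟨Ne.symm hpq, hq⟩)]
  have hq' : Q.erase q = {p, r, s} := by
    rw [← hQrs, erase_right_comm, insert_erase (mem_erase.2 ⟨hpq, hp⟩)]
  obtain ⟨hrp, hr⟩ := mem_erase.1 (hp' ▸ (by simp) : r ∈ Q.erase p)
  obtain ⟨hsp, hs⟩ := mem_erase.1 (hp' ▸ (by simp) : s ∈ Q.erase p)
  have hrq := (mem_erase.1 (hq' ▸ (by simp) : r ∈ Q.erase q)).1
  have hsq := (mem_erase.1 (hq' ▸ (by simp) : s ∈ Q.erase q)).1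
  have h₁ := hP p (hQ hp) q (hQ hq) r (hQ hr) hpq hrp.symm hrq.symm
  have h₂ := hP p (hQ hp) r (hQ hr) s (hQ hs) hrp.symm hsp.symm hrs
  have h₃ := hP p (hQ hp) s (hQ hs) q (hQ hq) hsp.symm hpq hsq
  have h₄ := hP q (hQ hq) r (hQ hr) s (hQ hs) hrq.symm hsq.symm hrs
  have e₁ := signedArea_swap_left p q r
  have e₂ : signedArea q s p = -signedArea p s q := by unfold signedArea; ring
  have e₃ := signedArea_add p q r s
  rw [hp', coe_insert, coe_insert, coe_singleton, mem_convexHull_triple_iff h₁ h₂ h₃ h₄] at hpQ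
  rw [hq', coe_insert, coe_insert, coe_singleton,
    mem_convexHull_triple_iff (e₁ ▸ neg_ne_zero.2 h₁) h₄ (e₂ ▸ neg_ne_zero.2 h₃) h₂, e₁, e₂] at hqQ
  rcases hpQ with ⟨_, _, _⟩ | ⟨_, _, _⟩ <;> rcases hqQ with ⟨_, _, _⟩ | ⟨_, _, _⟩ <;> linarith

theorem convexPos_coe_iff (Q : Finset (ℝ × ℝ)) :
    ConvexPos (Q : Set (ℝ × ℝ)) ↔ ¬ ∃ p ∈ Q, p ∈ convexHull ℝ (Q.erase p : Set (ℝ × ℝ)) := by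
  simp [ConvexPos]

open Finset in
open scoped Classical in
/-- The number of convex quadrilaterals is determined by the numbers of points to the left of the
lines through two of the points. -/
theorem crNum_add_eq {P : Finset (ℝ × ℝ)}
    (hP : ∀ p ∈ P, ∀ q ∈ P, ∀ r ∈ P, p ≠ q → p ≠ r → q ≠ r → signedArea p q r ≠ 0) :
    crNum P + P.card * (P.card - 1).choose 3 = P.card.choose 4 +
      ∑ p ∈ P, ∑ q ∈ P, (P.filter fun r => 0 < signedArea p q r).card.choose 2 := by
  have hcr : crNum P = ((P.powersetCard 4).filter fun Q =>
      ¬ ∃ p ∈ Q, p ∈ convexHull ℝ (Q.erase p : Set (ℝ × ℝ))).card := by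
    rw [crNum, ← Set.ncard_coe_finset]
    congr 1
    ext Q
    simp [convexPos_coe_iff, and_assoc]
  have hquad := card_filter_exists_distinguished P 3
    (fun p T => p ∈ convexHull ℝ (T : Set (ℝ × ℝ)))
    fun Q hQ hcard p hp q hq => eq_of_mem_convexHull_erase hP hQ hcard hp hq
  have htriple : ∀ p ∈ P,
      (((P.erase p).powersetCard 3).filter fun T : Finset (ℝ × ℝ) =>
        p ∈ convexHull ℝ (T : Set (ℝ × ℝ))).card +
        ∑ q ∈ P, (P.filter fun r => 0 < signedArea p q r).card.choose 2 =
      (P.card - 1).choose 3 := by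
    intro p hp
    have hsource := card_triples_with_source (P.erase p) (fun q r => 0 < signedArea p q r)
      (fun q r h => by rw [signedArea_swap]; linarith)
    have hself : ∀ q, ((P.erase p).filter fun r => 0 < signedArea p q r) =
        P.filter fun r => 0 < signedArea p q r := by
      intro q
      ext r
      simp only [mem_filter, mem_erase, and_congr_left_iff, and_iff_right_iff_imp]
      rintro h - rfl
      simp [signedArea] at h
    have hzero : (P.filter fun r => 0 < signedArea p p r).card.choose 2 = 0 := by
      simp [signedArea]
    simp only [hself] at hsource
    rw [← add_sum_erase P _ hp, hzero, zero_add, ← hsource, ← card_erase_of_mem hp,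
      ← card_powersetCard, filter_congr fun T hT => mem_convexHull_iff_not_exists_source hP hp
        (mem_powersetCard.1 hT).1 (mem_powersetCard.1 hT).2, add_comm]
    exact card_filter_add_card_filter_not _
  have htotal := sum_congr rfl htriple
  rw [sum_add_distrib, ← hquad, sum_const, smul_eq_mul] at htotal
  rw [hcr, ← htotal, ← card_powersetCard, ← add_assoc, add_comm (card _) (card _)]
  congr 1
  exact card_filter_add_card_filter_not _

/-- Whether `r` lies to the left of the line from `p` to `q`. This and `leftCount` are written with
the operations that the kernel evaluates fastest. -/
def isLeft (p q r : ℕ × ℕ) : Bool :=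
  Nat.blt (Nat.add (Nat.add (Nat.mul p.2 q.1) (Nat.mul q.2 r.1)) (Nat.mul p.1 r.2))
    (Nat.add (Nat.add (Nat.mul p.1 q.2) (Nat.mul q.1 r.2)) (Nat.mul p.2 r.1))

/-- The number of points of `L` to the left of the line from `p` to `q`. -/
def leftCount (L : List (ℕ × ℕ)) (p q : ℕ × ℕ) : ℕ :=
  @List.rec (ℕ × ℕ) (fun _ => ℕ) 0
    (fun r _ n => Nat.add n (@Bool.rec (fun _ => ℕ) 0 1 (isLeft p q r))) L

theorem leftCount_eq_countP (L : List (ℕ × ℕ)) (p q : ℕ × ℕ) :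
    leftCount L p q = L.countP (isLeft p q) := by
  induction L with
  | nil => rfl
  | cons r L ih =>
    rw [List.countP_cons, ← ih]
    change leftCount L p q + _ = _
    cases isLeft p q r <;> rfl

/-- The inclusion of the nonnegative integer lattice in the plane. -/
def latticeEmbedding : ℕ × ℕ ↪ ℝ × ℝ :=
  Nat.castEmbedding.prodMap Nat.castEmbedding

theorem isLeft_iff (p q r : ℕ × ℕ) : isLeft p q r = true ↔
    0 < signedArea (latticeEmbedding p) (latticeEmbedding q) (latticeEmbedding r) := by
  have h : isLeft p q r = true ↔
      p.2 * q.1 + q.2 * r.1 + p.1 * r.2 < p.1 * q.2 + q.1 * r.2 + p.2 * r.1 := by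
    unfold isLeft
    rw [Nat.blt_eq]
    rfl
  rw [h, ← Nat.cast_lt (α := ℝ), ← sub_pos]
  push_cast
  refine iff_of_eq (congrArg (0 < ·) ?_)
  simp only [signedArea, latticeEmbedding, Function.Embedding.coe_prodMap, Prod.map_fst,
    Prod.map_snd, Nat.castEmbedding_apply]
  ring

theorem leftCount_eq_card {L : List (ℕ × ℕ)} (hL : L.Nodup) (p q : ℕ × ℕ) :
    leftCount L p q = (L.toFinset.filter fun r => isLeft p q r).card := by
  rw [leftCount_eq_countP, List.countP_eq_length_filter, ← List.toFinset_filter,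
    List.toFinset_card_of_nodup (hL.filter _)]

/-- The sum of the left counts over the ordered pairs from `R` and `L`. -/
def leftSum (L R : List (ℕ × ℕ)) : ℕ :=
  (R.map fun p => (L.map fun q => leftCount L p q).sum).sum

/-- The sum over the ordered pairs from `R` and `L` of the number of pairs of points to the left. -/
def leftPairSum (L R : List (ℕ × ℕ)) : ℕ :=
  (R.map fun p => (L.map fun q => leftCount L p q * (leftCount L p q - 1) / 2).sum).sum

theorem leftSum_append (L R S : List (ℕ × ℕ)) :
    leftSum L (R ++ S) = leftSum L R + leftSum L S := by
  simp [leftSum]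

theorem leftPairSum_append (L R S : List (ℕ × ℕ)) :
    leftPairSum L (R ++ S) = leftPairSum L R + leftPairSum L S := by
  simp [leftPairSum]

theorem leftCount_self (L : List (ℕ × ℕ)) (p : ℕ × ℕ) : leftCount L p p = 0 := by
  rw [leftCount_eq_countP, List.countP_eq_zero]
  intro r _
  rw [isLeft_iff]
  simp [signedArea]

open Finset in
theorem disjoint_filter_isLeft (s : Finset (ℕ × ℕ)) (p q : ℕ × ℕ) :
    Disjoint (s.filter fun r => isLeft p q r) (s.filter fun r => isLeft q p r) := by
  refine disjoint_filter.2 fun r _ h h' => ?_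
  rw [isLeft_iff] at h h'
  rw [signedArea_swap_left] at h'
  linarith

open Finset in
theorem leftCount_add_leftCount_eq_card {L : List (ℕ × ℕ)} (hL : L.Nodup) (p q : ℕ × ℕ) :
    leftCount L p q + leftCount L q p =
      (L.toFinset.filter fun r => isLeft p q r ∨ isLeft q p r).card := by
  rw [leftCount_eq_card hL, leftCount_eq_card hL,
    ← card_union_of_disjoint (disjoint_filter_isLeft _ p q), filter_or]

open Finset in
/-- The points of a line through `p` and `q` are on neither of its sides. -/
theorem leftCount_add_leftCount_le {L : List (ℕ × ℕ)} (hL : L.Nodup) {t : Finset (ℕ × ℕ)}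
    (ht : t ⊆ L.toFinset) {p q : ℕ × ℕ} (hline : ∀ r ∈ t,
      signedArea (latticeEmbedding p) (latticeEmbedding q) (latticeEmbedding r) = 0) :
    leftCount L p q + leftCount L q p ≤ L.length - t.card := by
  rw [leftCount_add_leftCount_eq_card hL, ← List.toFinset_card_of_nodup hL,
    ← card_sdiff_of_subset ht]
  refine card_le_card fun r hr => ?_
  obtain ⟨hr, hside⟩ := mem_filter.1 hr
  refine mem_sdiff.2 ⟨hr, fun hrt => ?_⟩
  rw [isLeft_iff, isLeft_iff, signedArea_swap_left (latticeEmbedding p), hline r hrt] at hside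
  simp at hside

open Finset in
/-- If the left counts have the largest sum possible, then no three points are collinear. -/
theorem signedArea_latticeEmbedding_ne_zero {L : List (ℕ × ℕ)} (hL : L.Nodup)
    (hsum : L.length * (L.length - 1) * (L.length - 2) ≤ 2 * leftSum L L) {p q r : ℕ × ℕ}
    (hp : p ∈ L) (hq : q ∈ L) (hr : r ∈ L) (hpq : p ≠ q) (hpr : p ≠ r) (hqr : q ≠ r) :
    signedArea (latticeEmbedding p) (latticeEmbedding q) (latticeEmbedding r) ≠ 0 := by
  intro hzero
  have hline : ∀ a b : ℕ × ℕ, ∀ c ∈ ({a, b} : Finset (ℕ × ℕ)),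
      signedArea (latticeEmbedding a) (latticeEmbedding b) (latticeEmbedding c) = 0 := by
    intro a b c hc
    rcases mem_insert.1 hc with rfl | hc
    · simp [signedArea]
    · rw [mem_singleton.1 hc]
      simp [signedArea, mul_comm]
  have hle : ∀ x ∈ L.toFinset.offDiag,
      leftCount L x.1 x.2 + leftCount L x.2 x.1 ≤ L.length - 2 := by
    intro x hx
    obtain ⟨h₁, h₂, hne⟩ := mem_offDiag.1 hx
    rw [← card_pair hne]
    exact leftCount_add_leftCount_le hL (by simp_all [insert_subset_iff]) (hline _ _)
  have hthree : ({p, q, r} : Finset (ℕ × ℕ)) ⊆ L.toFinset := by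
    simp [insert_subset_iff, hp, hq, hr]
  have hcard : ({p, q, r} : Finset (ℕ × ℕ)).card = 3 :=
    card_eq_three.2 ⟨p, q, r, hpq, hpr, hqr, rfl⟩
  have hlt : leftCount L p q + leftCount L q p < L.length - 2 := by
    have hlen := card_le_card hthree
    have h := leftCount_add_leftCount_le hL hthree (p := p) (q := q) fun c hc => by
      rcases mem_insert.1 hc with rfl | hc
      · exact hline _ _ _ (by simp)
      · rcases mem_insert.1 hc with rfl | hc
        · exact hline _ _ _ (by simp)
        · rwa [mem_singleton.1 hc]
    rw [hcard, List.toFinset_card_of_nodup hL] at hlen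
    rw [hcard] at h
    omega
  have htotal : ∑ x ∈ L.toFinset.offDiag, (leftCount L x.1 x.2 + leftCount L x.2 x.1) =
      2 * leftSum L L := by
    have hdiag : ∑ x ∈ L.toFinset.diag, (leftCount L x.1 x.2 + leftCount L x.2 x.1) = 0 :=
      sum_eq_zero fun x hx => by
        rw [(mem_diag.1 hx).2, leftCount_self, add_zero]
    rw [← zero_add (∑ x ∈ _, _), ← hdiag, ← sum_union (disjoint_diag_offDiag _), diag_union_offDiag,
      sum_add_distrib, sum_product, sum_product_right, ← two_mul, leftSum,
      ← List.sum_toFinset _ hL]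
    simp only [← List.sum_toFinset _ hL]
  have hstrict := sum_lt_sum hle ⟨(p, q), by simp [hp, hq, hpq], hlt⟩
  rw [htotal, sum_const, offDiag_card, List.toFinset_card_of_nodup hL, smul_eq_mul,
    ← Nat.mul_sub_one] at hstrict
  exact absurd hsum hstrict.not_ge

/-- Ninety lattice points; up to translation, each line is an orbit of `(x, y) ↦ (-y, x - y)`. -/
def latticePoints : List (ℕ × ℕ) := [
  (1750277, 3021386), (30533046, 15506107), (18048325, 31804155),
  (18120780, 32649318), (905114, 2248678), (31305754, 15433652),
  (18115413, 32582951), (971481, 2309678), (31244754, 15439019),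
  (11455202, 12157167), (21397265, 16075251), (17479181, 22099230),
  (9571998, 9841818), (23712614, 16507396), (17047036, 23982434),
  (17964430, 30722738), (2831694, 4018908), (29535524, 15590002),
  (17575213, 18382866), (15171566, 15969563), (17584869, 15979219),
  (15169254, 15960792), (17593640, 15985678), (17568754, 18385178),
  (18072084, 32061950), (1492482, 2787350), (30767082, 15482348),
  (26434035, 15834919), (17719513, 27376332), (6178100, 7120397),
  (4044633, 5081691), (28472741, 15740158), (17814274, 29509799),
  (21936501, 16183581), (17370851, 22530136), (11024296, 11617931),
  (15175494, 15985463), (17568969, 15967247), (17587185, 18378938),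
  (11349276, 12020288), (21534144, 16106204), (17448228, 22205156),
  (27289496, 15779202), (17775230, 28287510), (5266922, 6264936),
  (17756773, 28046824), (5507608, 6487165), (27067267, 15797659),
  (27229340, 15791383), (17763049, 28215173), (5339259, 6325092),
  (16166967, 18902309), (14652123, 14041874), (19512558, 17387465),
  (12025917, 12873016), (20681416, 15930117), (17624315, 21528515),
  (23434066, 16567534), (16986898, 23643748), (9910684, 10120366),
  (20539756, 15932744), (17621688, 21384228), (12170204, 13014676),
  (17890914, 30082255), (3472177, 4585875), (28968557, 15663518),
  (19526943, 17397647), (16156785, 18906512), (14647920, 14027489),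
  (14472729, 13949863), (19604569, 17300082), (16254350, 19081703),
  (9009647, 9378239), (24176193, 16408624), (17145808, 24544785),
  (24132450, 16420069), (17134363, 24489597), (9064835, 9421982),
  (19480061, 17420324), (16134108, 18836953), (14717479, 14074371),
  (18153654, 33043527), (510905, 1887343), (31667089, 15400778),
  (19597514, 17310045), (16244387, 19064685), (14489747, 13956918),
  (4530467, 5546809), (28007623, 15760874), (17793558, 29023965)]

theorem nodup_latticePoints : latticePoints.Nodup := by
  decide +kernel

/-- The points with indices from `15 * i` to `15 * i + 14`. -/
def latticeBlock (i : ℕ) : List (ℕ × ℕ) :=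
  (latticePoints.drop (15 * i)).take 15

theorem sums_latticeBlock_zero :
    leftSum latticePoints (latticeBlock 0) = 58740 ∧
      leftPairSum latticePoints (latticeBlock 0) = 1532196 := by
  decide +kernel

theorem sums_latticeBlock_one :
    leftSum latticePoints (latticeBlock 1) = 58740 ∧
      leftPairSum latticePoints (latticeBlock 1) = 1445373 := by
  decide +kernel

theorem sums_latticeBlock_two :
    leftSum latticePoints (latticeBlock 2) = 58740 ∧
      leftPairSum latticePoints (latticeBlock 2) = 1408257 := by
  decide +kernel

theorem sums_latticeBlock_three :
    leftSum latticePoints (latticeBlock 3) = 58740 ∧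
      leftPairSum latticePoints (latticeBlock 3) = 1391280 := by
  decide +kernel

theorem sums_latticeBlock_four :
    leftSum latticePoints (latticeBlock 4) = 58740 ∧
      leftPairSum latticePoints (latticeBlock 4) = 1390233 := by
  decide +kernel

theorem sums_latticeBlock_five :
    leftSum latticePoints (latticeBlock 5) = 58740 ∧
      leftPairSum latticePoints (latticeBlock 5) = 1449690 := by
  decide +kernel

theorem latticePoints_eq_append : latticePoints = latticeBlock 0 ++ (latticeBlock 1 ++
    (latticeBlock 2 ++ (latticeBlock 3 ++ (latticeBlock 4 ++ latticeBlock 5)))) :=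
  rfl

theorem leftSum_latticePoints : leftSum latticePoints latticePoints = 352440 := by
  conv_lhs => arg 2; rw [latticePoints_eq_append]
  simp only [leftSum_append, sums_latticeBlock_zero.1, sums_latticeBlock_one.1,
    sums_latticeBlock_two.1, sums_latticeBlock_three.1, sums_latticeBlock_four.1,
    sums_latticeBlock_five.1]

theorem leftPairSum_latticePoints : leftPairSum latticePoints latticePoints = 8617029 := by
  conv_lhs => arg 2; rw [latticePoints_eq_append]
  simp only [leftPairSum_append, sums_latticeBlock_zero.2, sums_latticeBlock_one.2,
    sums_latticeBlock_two.2, sums_latticeBlock_three.2, sums_latticeBlock_four.2,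
    sums_latticeBlock_five.2]

/-- There is a set of 90 points in general position with exactly 951459 convex
quadrilaterals; in particular the rectilinear crossing number of `K_90` is at most 951459. -/
theorem exists_good_drawing_K90 :
    ∃ P : Finset (ℝ × ℝ), P.card = 90 ∧ GenPos P ∧ crNum P = 951459 ∧
      rcn 90 ≤ 951459 := by
  have hlen : latticePoints.length = 90 := rfl
  set P := latticePoints.toFinset.map latticeEmbedding with hP
  have hcard : P.card = 90 := by
    rw [hP, Finset.card_map, List.toFinset_card_of_nodup nodup_latticePoints, hlen]
  have hne : ∀ p ∈ P, ∀ q ∈ P, ∀ r ∈ P, p ≠ q → p ≠ r → q ≠ r → signedArea p q r ≠ 0 := by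
    simp only [hP, Finset.forall_mem_map, List.mem_toFinset, latticeEmbedding.injective.ne_iff]
    intro p hp q hq r hr hpq hpr hqr
    exact signedArea_latticeEmbedding_ne_zero nodup_latticePoints
      (by rw [hlen, leftSum_latticePoints]) hp hq hr hpq hpr hqr
  have hgen : GenPos P := fun p hp q hq r hr hpq hpr hqr hcol =>
    hne p hp q hq r hr hpq hpr hqr (signedArea_eq_zero_of_collinear hcol)
  have hsum : ∑ p ∈ P, ∑ q ∈ P, (P.filter fun r => 0 < signedArea p q r).card.choose 2 =
      8617029 := by
    rw [← leftPairSum_latticePoints, leftPairSum, ← List.sum_toFinset _ nodup_latticePoints, hP,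
      Finset.sum_map]
    refine Finset.sum_congr rfl fun p _ => ?_
    rw [← List.sum_toFinset _ nodup_latticePoints, Finset.sum_map]
    refine Finset.sum_congr rfl fun q _ => ?_
    rw [Finset.filter_map, Finset.card_map, Nat.choose_two_right,
      leftCount_eq_card nodup_latticePoints]
    simp only [isLeft_iff, Function.comp_def]
  have hcr : crNum P = 951459 := by
    have h := crNum_add_eq hne
    have h₃ : Nat.choose 89 3 = 113564 := by decide +kernel
    have h₄ : Nat.choose 90 4 = 2555190 := by decide +kernel
    rw [hsum, hcard, h₃, h₄] at h
    omega
  exact ⟨P, hcard, hgen, hcr, Nat.sInf_le ⟨P, hcard, hgen, hcr⟩⟩
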